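/- arXiv:1701.06317 — 5 statements merged into one kernel-verified Lean document; each statement's English description precedes it below -/
import Mathlib

section
/- Let q ∈ Q with |q| ≥ Γ, and let l ∈ {1, …, m} be the Γ-th smallest index of an element of q, i.e., e_l ∈ q and |{j ≤ l : e_j ∈ q}| = Γ. Then zBS^l(q) = zRC(q) and zBS^{l+1}(q) = zRC(q). -/
open Finset

/-- The cardinality-constrained uncertainty set: all cost functions `c` with
`n e ≤ c e ≤ n e + δ e` for every element, and at most `Γ` elements with `c e > n e`. -/
def Uset {E : Type*} [Fintype E] [DecidableEq E] (n δ : E → ℝ) (Γ : ℕ) : Set (E → ℝ) :=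
  {c | (∀ e, n e ≤ c e ∧ c e ≤ n e + δ e) ∧
    (Finset.univ.filter fun e => n e < c e).card ≤ Γ}

/-- The worst-case cost `zRC(q) = max_{c ∈ U} ∑_{e ∈ q} c e`. -/
noncomputable def zRC {E : Type*} [Fintype E] [DecidableEq E] (n δ : E → ℝ) (Γ : ℕ)
    (q : Finset E) : ℝ :=
  sSup {x : ℝ | ∃ c ∈ Uset n δ Γ, x = ∑ e ∈ q, c e}

/-- `δ̄_l` for `l ∈ {1,…,m}` (1-based), and `δ̄_{m+1} = 0`, where the enumeration
`e : Fin m ≃ E` lists the elements in order of decreasing interval length. -/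
noncomputable def dbar {E : Type*} [Fintype E] (δ : E → ℝ)
    (e : Fin (Fintype.card E) ≃ E) (l : ℕ) : ℝ :=
  if h : l - 1 < Fintype.card E then δ (e ⟨l - 1, h⟩) else 0

/-- The subproblem objective
`zBS^l(q) = ∑_{e∈q} n e + Γ·δ̄_l + ∑_{e_j ∈ q, j ≤ l} (δ_{e_j} − δ̄_l)`,
where `e_j` has 1-based index `j`, i.e. `j = (e.symm x : ℕ) + 1`. -/
noncomputable def zBS {E : Type*} [Fintype E] [DecidableEq E] (n δ : E → ℝ) (Γ : ℕ)
    (e : Fin (Fintype.card E) ≃ E) (l : ℕ) (q : Finset E) : ℝ :=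
  (∑ x ∈ q, n x) + Γ * dbar δ e l +
    ∑ x ∈ q.filter (fun x => ((e.symm x : ℕ) + 1 ≤ l)), (δ x - dbar δ e l)

/-- If `T` consists of `Γ` elements of `q` on which `δ` is at least `d`, and `δ` is at most `d`
on the rest of `q`, then the worst case raises exactly the costs of the elements of `T`. -/
theorem zRC_eq_of_threshold {E : Type*} [Fintype E] [DecidableEq E] {n δ : E → ℝ}
    (hδ : ∀ x, 0 ≤ δ x) {Γ : ℕ} {q T : Finset E} (hTq : T ⊆ q) (hT : T.card = Γ) {d : ℝ}
    (hd : 0 ≤ d) (hge : ∀ x ∈ T, d ≤ δ x) (hle : ∀ x ∈ q, x ∉ T → δ x ≤ d) :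
    zRC n δ Γ q = ∑ x ∈ q, n x + ∑ x ∈ T, δ x := by
  refine IsGreatest.csSup_eq ⟨⟨fun x => n x + if x ∈ T then δ x else 0, ⟨fun x => ?_, ?_⟩, ?_⟩, ?_⟩
  · have := hδ x
    dsimp only
    split_ifs <;> constructor <;> linarith
  · rw [← hT]
    refine card_le_card fun x hx => ?_
    by_contra h
    simp [h] at hx
  · rw [sum_add_distrib, ← sum_filter, filter_mem_eq_inter, inter_eq_right.2 hTq]
  · rintro _ ⟨c, ⟨hc, hcΓ⟩, rfl⟩
    set S := univ.filter fun x => n x < c x with hS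
    have hpt : ∀ x ∈ q, c x ≤ n x + ((if x ∈ S then d else 0) +
        if x ∈ T then δ x - d else 0) := by
      intro x hx
      have hcx := hc x
      by_cases hxS : x ∈ S <;> by_cases hxT : x ∈ T <;> simp only [hxS, hxT, if_true, if_false]
      · linarith
      · linarith [hle x hx hxT]
      · have : c x ≤ n x := by simpa [hS] using hxS
        linarith [hge x hxT]
      · have : c x ≤ n x := by simpa [hS] using hxS
        linarith
    have hcardS : ((q ∩ S).card : ℝ) * d ≤ Γ * d := by
      gcongr
      exact (card_le_card inter_subset_right).trans hcΓ
    calc ∑ x ∈ q, c x ≤ _ := sum_le_sum hpt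
      _ = ∑ x ∈ q, n x + ((q ∩ S).card * d + (∑ x ∈ T, δ x - Γ * d)) := by
        rw [sum_add_distrib, sum_add_distrib, ← sum_filter, ← sum_filter, filter_mem_eq_inter,
          filter_mem_eq_inter, inter_eq_right.2 hTq, sum_sub_distrib, sum_const, sum_const, hT,
          nsmul_eq_mul, nsmul_eq_mul]
      _ ≤ _ := by linarith

/-- If the `Γ`-element set `T` is contained in the index range of `zBS` at `l`, and the other
elements of that range have interval length `dbar δ e l`, then only `T` contributes. -/
theorem zBS_eq_of_subset {E : Type*} [Fintype E] [DecidableEq E] {n δ : E → ℝ} {Γ : ℕ}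
    {e : Fin (Fintype.card E) ≃ E} {l : ℕ} {q T : Finset E} (hT : T.card = Γ)
    (hsub : T ⊆ q.filter fun x => (e.symm x : ℕ) + 1 ≤ l)
    (heq : ∀ x ∈ q.filter (fun x => (e.symm x : ℕ) + 1 ≤ l), x ∉ T → δ x = dbar δ e l) :
    zBS n δ Γ e l q = ∑ x ∈ q, n x + ∑ x ∈ T, δ x := by
  rw [zBS, ← sum_subset hsub fun x hx hxT => sub_eq_zero.2 (heq x hx hxT), sum_sub_distrib,
    sum_const, hT, nsmul_eq_mul]
  ring

/-- If `|q| ≥ Γ` and `e_l` (here `l : Fin m`, so its 1-based index is `l+1 ∈ {1,…,m}`)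
is the element of `q` with the `Γ`-th smallest index, then
`zBS^{l+1}(q) = zRC(q)` and `zBS^{l+2}(q) = zRC(q)` (in 1-based numbering,
`zBS^l(q) = zRC(q)` and `zBS^{l+1}(q) = zRC(q)`). -/
theorem stmt3 {E : Type*} [Fintype E] [DecidableEq E] [Nonempty E]
    (Q : Set (Finset E)) (hQ : Q.Nonempty)
    (n δ : E → ℝ) (hδ : ∀ x, 0 ≤ δ x)
    (Γ : ℕ) (hΓ1 : 1 ≤ Γ) (hΓ2 : Γ ≤ Fintype.card E)
    (e : Fin (Fintype.card E) ≃ E)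
    (hsort : ∀ i j : Fin (Fintype.card E), i ≤ j → δ (e j) ≤ δ (e i))
    (q : Finset E) (hq : q ∈ Q) (hcard : Γ ≤ q.card)
    (l : Fin (Fintype.card E)) (hel : e l ∈ q)
    (hΓl : (Finset.univ.filter fun j : Fin (Fintype.card E) => j ≤ l ∧ e j ∈ q).card = Γ) :
    zBS n δ Γ e ((l : ℕ) + 1) q = zRC n δ Γ q ∧
    zBS n δ Γ e ((l : ℕ) + 2) q = zRC n δ Γ q := by
  have hT : (q.filter fun x => (e.symm x : ℕ) + 1 ≤ (l : ℕ) + 1).card = Γ := by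
    rw [← hΓl, ← card_map e.toEmbedding]
    congr 1
    ext x
    simp only [mem_filter, mem_map_equiv, mem_univ, true_and, Equiv.apply_symm_apply, Fin.le_def]
    rw [and_comm, Nat.add_le_add_iff_right]
  rw [zRC_eq_of_threshold hδ (filter_subset _ _) hT (hδ (e l))]
  · refine ⟨zBS_eq_of_subset hT (Subset.refl _) fun x hx hxT => absurd hx hxT,
      zBS_eq_of_subset hT (fun x hx => ?_) fun x hx hxT => ?_⟩
    · rw [mem_filter] at hx ⊢
      exact ⟨hx.1, by omega⟩
    · rw [mem_filter] at hx hxT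
      have hidx : (e.symm x : ℕ) = (l : ℕ) + 1 := by
        have : ¬ (e.symm x : ℕ) + 1 ≤ (l : ℕ) + 1 := fun h => hxT ⟨hx.1, h⟩
        omega
      have hlt : (l : ℕ) + 2 - 1 < Fintype.card E := by
        have := (e.symm x).isLt
        omega
      have hx' : (⟨(l : ℕ) + 2 - 1, hlt⟩ : Fin (Fintype.card E)) = e.symm x :=
        Fin.ext (by simp [hidx])
      rw [dbar, dif_pos hlt, hx', Equiv.apply_symm_apply]
  · intro x hx
    have h : e.symm x ≤ l := Fin.le_def.2 (Nat.le_of_succ_le_succ (mem_filter.1 hx).2)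
    simpa using hsort _ _ h
  · intro x hx hxT
    have h : l ≤ e.symm x := by
      by_contra! h
      exact hxT (mem_filter.2 ⟨hx, Nat.succ_le_succ (Fin.le_def.1 h.le)⟩)
    simpa using hsort _ _ h
end

section
/- Suppose that for each l ∈ {1, …, m+1}, q^l ∈ Q minimizes zBS^l over Q. Then min_{1 ≤ l ≤ m+1} zRC(q^l) = min_{q ∈ Q} zRC(q); in particular, any q^{l*} whose worst-case cost zRC(q^{l*}) is minimal among zRC(q^1), …, zRC(q^{m+1}) is a minmax robust optimal solution, i.e., minimizes zRC over Q. -/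
open Finset

section

variable {E : Type*} [Fintype E] {n δ : E → ℝ} {Γ : ℕ}
  {e : Fin (Fintype.card E) ≃ E}

theorem dbar_nonneg (hδ : ∀ x, 0 ≤ δ x) (l : ℕ) : 0 ≤ dbar δ e l := by
  unfold dbar
  split_ifs
  · exact hδ _
  · exact le_rfl

theorem dbar_le_of_index_le (hδ : ∀ x, 0 ≤ δ x)
    (hsort : ∀ i j : Fin (Fintype.card E), i ≤ j → δ (e j) ≤ δ (e i))
    {l : ℕ} {x : E} (hx : (e.symm x : ℕ) + 1 ≤ l) : dbar δ e l ≤ δ x := by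
  unfold dbar
  split_ifs with h
  · simpa using hsort (e.symm x) ⟨l - 1, h⟩ (Fin.le_def.2 (by simp only; omega))
  · exact hδ _

theorem le_dbar_of_lt_index
    (hsort : ∀ i j : Fin (Fintype.card E), i ≤ j → δ (e j) ≤ δ (e i))
    {l : ℕ} {x : E} (hx : ¬ (e.symm x : ℕ) + 1 ≤ l) : δ x ≤ dbar δ e l := by
  have hlt := (e.symm x).isLt
  have h : l - 1 < Fintype.card E := by omega
  rw [dbar, dif_pos h]
  simpa using hsort ⟨l - 1, h⟩ (e.symm x) (Fin.le_def.2 (by simp only; omega))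

variable [DecidableEq E]

theorem sum_le_zBS (hδ : ∀ x, 0 ≤ δ x)
    (hsort : ∀ i j : Fin (Fintype.card E), i ≤ j → δ (e j) ≤ δ (e i))
    (l : ℕ) (q : Finset E) {c : E → ℝ} (hc : c ∈ Uset n δ Γ) :
    ∑ x ∈ q, c x ≤ zBS n δ Γ e l q := by
  obtain ⟨hc, hcard⟩ := hc
  have hpoint : ∀ x ∈ q, c x ≤ n x + (if n x < c x then dbar δ e l else 0) +
      (if (e.symm x : ℕ) + 1 ≤ l then δ x - dbar δ e l else 0) := by
    intro x _
    have h1 := hc x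
    have h2 : (e.symm x : ℕ) + 1 ≤ l → dbar δ e l ≤ δ x := dbar_le_of_index_le hδ hsort
    have h3 : ¬ (e.symm x : ℕ) + 1 ≤ l → δ x ≤ dbar δ e l := le_dbar_of_lt_index hsort
    split_ifs with ha hb hb
    · linarith
    · linarith [h3 hb]
    · linarith [h2 hb]
    · linarith
  have hcount : ∑ x ∈ q, (if n x < c x then dbar δ e l else 0) ≤ Γ * dbar δ e l := by
    rw [← sum_filter, sum_const, nsmul_eq_mul]
    refine mul_le_mul_of_nonneg_right ?_ (dbar_nonneg hδ l)
    exact_mod_cast (card_le_card (filter_subset_filter _ (subset_univ q))).trans hcard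
  have hsum := sum_le_sum hpoint
  rw [sum_add_distrib, sum_add_distrib, ← sum_filter (fun x => (e.symm x : ℕ) + 1 ≤ l)] at hsum
  unfold zBS
  linarith

theorem zRC_le_zBS (hδ : ∀ x, 0 ≤ δ x)
    (hsort : ∀ i j : Fin (Fintype.card E), i ≤ j → δ (e j) ≤ δ (e i))
    (l : ℕ) (q : Finset E) : zRC n δ Γ q ≤ zBS n δ Γ e l q := by
  refine csSup_le ⟨_, n, ⟨fun x => ⟨le_rfl, by linarith [hδ x]⟩, by simp⟩, rfl⟩ ?_
  rintro _ ⟨c, hc, rfl⟩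
  exact sum_le_zBS hδ hsort l q hc

theorem sum_add_sum_le_zRC (hδ : ∀ x, 0 ≤ δ x) {q S : Finset E} (hS : S ⊆ q)
    (hcard : S.card ≤ Γ) : ∑ x ∈ q, n x + ∑ x ∈ S, δ x ≤ zRC n δ Γ q := by
  have hbdd : BddAbove {x : ℝ | ∃ c ∈ Uset n δ Γ, x = ∑ y ∈ q, c y} := by
    refine ⟨∑ y ∈ q, (n y + δ y), ?_⟩
    rintro _ ⟨c, hc, rfl⟩
    exact sum_le_sum fun y _ => (hc.1 y).2
  refine le_csSup hbdd ⟨fun x => n x + if x ∈ S then δ x else 0, ⟨fun x => ?_, ?_⟩, ?_⟩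
  · have := hδ x
    dsimp only
    split_ifs <;> constructor <;> linarith
  · refine (card_le_card fun x hx => ?_).trans hcard
    by_contra hxS
    simp [hxS] at hx
  · rw [sum_add_distrib, sum_ite_mem, inter_eq_right.2 hS]

theorem exists_card_filter_index_eq (q : Finset E) (hΓ : 1 ≤ Γ) (hq : Γ ≤ q.card) :
    ∃ l, 1 ≤ l ∧ l ≤ Fintype.card E ∧
      (q.filter fun x => (e.symm x : ℕ) + 1 ≤ l).card = Γ := by
  have hall : (q.filter fun x => (e.symm x : ℕ) + 1 ≤ Fintype.card E) = q :=
    filter_true_of_mem fun x _ => (e.symm x).isLt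
  have hex : ∃ l, Γ ≤ (q.filter fun x => (e.symm x : ℕ) + 1 ≤ l).card :=
    ⟨Fintype.card E, by rwa [hall]⟩
  obtain ⟨l, hl, hmin⟩ : ∃ l, Γ ≤ (q.filter fun x => (e.symm x : ℕ) + 1 ≤ l).card ∧
      ∀ k < l, (q.filter fun x => (e.symm x : ℕ) + 1 ≤ k).card < Γ :=
    ⟨Nat.find hex, Nat.find_spec hex, fun k hk => not_le.1 (Nat.find_min hex hk)⟩
  have hpos : l ≠ 0 := by
    rintro rfl
    simp at hl
    omega
  have hle : l ≤ Fintype.card E := by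
    by_contra! h
    have := hmin _ h
    rw [hall] at this
    omega
  refine ⟨l, by omega, hle, le_antisymm ?_ hl⟩
  have hlt : l - 1 < Fintype.card E := by omega
  have hsub : (q.filter fun x => (e.symm x : ℕ) + 1 ≤ l) ⊆
      insert (e ⟨l - 1, hlt⟩) (q.filter fun x => (e.symm x : ℕ) + 1 ≤ l - 1) := by
    intro x hx
    obtain ⟨hxq, hxl⟩ := mem_filter.1 hx
    rw [mem_insert, mem_filter]
    by_cases h : (e.symm x : ℕ) + 1 ≤ l - 1
    · exact Or.inr ⟨hxq, h⟩
    · left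
      rw [← Equiv.symm_apply_eq]
      apply Fin.ext
      simp only
      omega
  have h1 := (card_le_card hsub).trans (card_insert_le _ _)
  have h2 := hmin (l - 1) (by omega)
  omega

theorem exists_zBS_le_zRC (hδ : ∀ x, 0 ≤ δ x) (hΓ : 1 ≤ Γ) (q : Finset E) :
    ∃ l, 1 ≤ l ∧ l ≤ Fintype.card E + 1 ∧ zBS n δ Γ e l q ≤ zRC n δ Γ q := by
  rcases le_total Γ q.card with hq | hq
  · obtain ⟨l, h1, h2, hcard⟩ := exists_card_filter_index_eq (e := e) q hΓ hq
    refine ⟨l, h1, by omega, ?_⟩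
    have h := sum_add_sum_le_zRC (n := n) hδ (filter_subset _ q) hcard.le
    rw [zBS, sum_sub_distrib, sum_const, hcard, nsmul_eq_mul]
    linarith
  · refine ⟨Fintype.card E + 1, by omega, le_rfl, ?_⟩
    have h := sum_add_sum_le_zRC (n := n) hδ (Subset.refl q) hq
    have hd : dbar δ e (Fintype.card E + 1) = 0 := by simp [dbar]
    rw [zBS, hd, filter_true_of_mem fun x _ => by have := (e.symm x).isLt; omega]
    simpa using h

end

/-- Suppose for each `l ∈ {1,…,m+1}` the solution `q^l ∈ Q` minimizes `zBS^l` over `Q`.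
Then `min_{1 ≤ l ≤ m+1} zRC(q^l) = min_{q ∈ Q} zRC(q)`; in particular any `q^{l*}` whose
worst-case cost is minimal among `zRC(q^1),…,zRC(q^{m+1})` minimizes `zRC` over `Q`. -/
theorem stmt5 {E : Type*} [Fintype E] [DecidableEq E] [Nonempty E]
    (Q : Set (Finset E)) (hQ : Q.Nonempty)
    (n δ : E → ℝ) (hδ : ∀ x, 0 ≤ δ x)
    (Γ : ℕ) (hΓ1 : 1 ≤ Γ) (hΓ2 : Γ ≤ Fintype.card E)
    (e : Fin (Fintype.card E) ≃ E)
    (hsort : ∀ i j : Fin (Fintype.card E), i ≤ j → δ (e j) ≤ δ (e i))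
    (ql : ℕ → Finset E)
    (hmem : ∀ l, 1 ≤ l → l ≤ Fintype.card E + 1 → ql l ∈ Q)
    (hopt : ∀ l, 1 ≤ l → l ≤ Fintype.card E + 1 →
      ∀ q ∈ Q, zBS n δ Γ e l (ql l) ≤ zBS n δ Γ e l q) :
    sInf {x : ℝ | ∃ l, 1 ≤ l ∧ l ≤ Fintype.card E + 1 ∧ x = zRC n δ Γ (ql l)} =
      sInf {x : ℝ | ∃ q ∈ Q, x = zRC n δ Γ q} ∧
    ∀ lstar, 1 ≤ lstar → lstar ≤ Fintype.card E + 1 →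
      (∀ l, 1 ≤ l → l ≤ Fintype.card E + 1 → zRC n δ Γ (ql lstar) ≤ zRC n δ Γ (ql l)) →
      ∀ q ∈ Q, zRC n δ Γ (ql lstar) ≤ zRC n δ Γ q := by
  have key : ∀ q ∈ Q, ∃ l, 1 ≤ l ∧ l ≤ Fintype.card E + 1 ∧ zRC n δ Γ (ql l) ≤ zRC n δ Γ q := by
    intro q hq
    obtain ⟨l, h1, h2, hl⟩ := exists_zBS_le_zRC (n := n) (e := e) hδ hΓ1 q
    exact ⟨l, h1, h2, (zRC_le_zBS hδ hsort l (ql l)).trans ((hopt l h1 h2 q hq).trans hl)⟩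
  have hsub : {x : ℝ | ∃ l, 1 ≤ l ∧ l ≤ Fintype.card E + 1 ∧ x = zRC n δ Γ (ql l)} ⊆
      {x : ℝ | ∃ q ∈ Q, x = zRC n δ Γ q} := by
    rintro _ ⟨l, h1, h2, rfl⟩
    exact ⟨ql l, hmem l h1 h2, rfl⟩
  have hbdd : BddBelow {x : ℝ | ∃ q ∈ Q, x = zRC n δ Γ q} := by
    refine ((Set.finite_range (zRC n δ Γ)).subset ?_).bddBelow
    rintro _ ⟨q, _, rfl⟩
    exact ⟨q, rfl⟩
  refine ⟨le_antisymm ?_ ?_, fun lstar _ _ hmin q hq => ?_⟩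
  · obtain ⟨q₀, hq₀⟩ := hQ
    refine le_csInf ⟨_, q₀, hq₀, rfl⟩ ?_
    rintro _ ⟨q, hq, rfl⟩
    obtain ⟨l, h1, h2, hl⟩ := key q hq
    exact csInf_le_of_le (hbdd.mono hsub) ⟨l, h1, h2, rfl⟩ hl
  · exact csInf_le_csInf hbdd ⟨_, 1, le_rfl, by omega, rfl⟩ hsub
  · obtain ⟨l, h1, h2, hl⟩ := key q hq
    exact (hmin l h1 h2).trans hl
end

section
/- Under objective independent element order, for every q ∈ Q there exists an index l with Γ_1 ≤ l ≤ m+1 such that zBS^l_i(q) = zRC_i(q) for all i ∈ {1, …, k} simultaneously. -/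
open Finset

/-- The multi-objective cardinality-constrained uncertainty set: all cost functions `c` with
`n e i ≤ c e i ≤ n e i + δ e i` for all `e, i`, and, for each objective `i`,
at most `Γ i` elements with `c e i > n e i`. -/
def Uk {E : Type*} [Fintype E] [DecidableEq E] {k : ℕ} (n δ : E → Fin k → ℝ)
    (Γ : Fin k → ℕ) : Set (E → Fin k → ℝ) :=
  {c | (∀ e i, n e i ≤ c e i ∧ c e i ≤ n e i + δ e i) ∧
    ∀ i, (Finset.univ.filter fun e => n e i < c e i).card ≤ Γ i}

/-- The worst-case cost vector: `zRC_i(q) = max_{c ∈ U} ∑_{e ∈ q} c e i`. -/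
noncomputable def zRCk {E : Type*} [Fintype E] [DecidableEq E] {k : ℕ}
    (n δ : E → Fin k → ℝ) (Γ : Fin k → ℕ) (q : Finset E) : Fin k → ℝ :=
  fun i => sSup {x : ℝ | ∃ c ∈ Uk n δ Γ, x = ∑ e ∈ q, c e i}

/-- `δ̄_{l,i}` for `l ∈ {1,…,m}` (1-based), and `δ̄_{m+1} = 0`, where the enumeration
`e : Fin m ≃ E` lists the elements in order of (componentwise) decreasing interval length. -/
noncomputable def dbarK {E : Type*} [Fintype E] {k : ℕ} (δ : E → Fin k → ℝ)
    (e : Fin (Fintype.card E) ≃ E) (l : ℕ) (i : Fin k) : ℝ :=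
  if h : l - 1 < Fintype.card E then δ (e ⟨l - 1, h⟩) i else 0

/-- The multi-objective subproblem objective (objective independent element order):
`zBS^l_i(q) = ∑_{e∈q} n e i + Γ_i·δ̄_{l,i} + ∑_{e_j ∈ q, j ≤ l} (δ_{e_j,i} − δ̄_{l,i})`,
where `e_j` has 1-based index `j = (e.symm x : ℕ) + 1`. -/
noncomputable def zBSk {E : Type*} [Fintype E] [DecidableEq E] {k : ℕ}
    (n δ : E → Fin k → ℝ) (Γ : Fin k → ℕ) (e : Fin (Fintype.card E) ≃ E)
    (l : ℕ) (q : Finset E) : Fin k → ℝ :=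
  fun i => (∑ x ∈ q, n x i) + Γ i * dbarK δ e l i +
    ∑ x ∈ q.filter (fun x => ((e.symm x : ℕ) + 1 ≤ l)), (δ x i - dbarK δ e l i)

/-- Among the first `l` elements of an enumeration there are at most `l` elements of `q`. -/
lemma card_filter_succ_le {E : Type*} {m : ℕ} (e : Fin m ≃ E) (q : Finset E) (l : ℕ) :
    (q.filter fun x => (e.symm x : ℕ) + 1 ≤ l).card ≤ l := by
  have h := Finset.card_le_card_of_injOn (s := q.filter fun x => (e.symm x : ℕ) + 1 ≤ l)
    (t := Finset.range l) (fun x => (e.symm x : ℕ))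
    (fun x hx => by
      have := (Finset.mem_filter.mp hx).2
      simp only [Finset.coe_range, Set.mem_Iio]
      omega)
    (fun x _ y _ hxy => e.symm.injective (Fin.ext hxy))
  simpa using h

/-- Going from the first `l` elements to the first `l + 1` adds at most one element of `q`. -/
lemma card_filter_succ_le_add_one {E : Type*} [DecidableEq E] {m : ℕ} (e : Fin m ≃ E)
    (q : Finset E) {l : ℕ} (hl : l < m) :
    (q.filter fun x => (e.symm x : ℕ) + 1 ≤ l + 1).card ≤
      (q.filter fun x => (e.symm x : ℕ) + 1 ≤ l).card + 1 := by
  refine (Finset.card_le_card (t := insert (e ⟨l, hl⟩)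
    (q.filter fun x => (e.symm x : ℕ) + 1 ≤ l)) fun x hx => ?_).trans
    (Finset.card_insert_le _ _)
  obtain ⟨hxq, hxl⟩ := Finset.mem_filter.mp hx
  rw [Finset.mem_insert, Finset.mem_filter]
  by_cases h : (e.symm x : ℕ) = l
  · left
    rw [← Equiv.symm_apply_eq]
    exact Fin.ext h
  · right
    exact ⟨hxq, by omega⟩

/-- There is a cut-off index `l ≥ g` such that either exactly `g` elements of `q` are among the
first `l` elements, or `l` is the last index `m + 1` and at most `g` elements of `q` are. -/
lemma exists_cutoff {E : Type*} [DecidableEq E] {m : ℕ} (e : Fin m ≃ E) (q : Finset E)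
    {g : ℕ} (hg : g ≤ m) :
    ∃ l, g ≤ l ∧ l ≤ m + 1 ∧
      (q.filter fun x => (e.symm x : ℕ) + 1 ≤ l).card ≤ g ∧
      ((q.filter fun x => (e.symm x : ℕ) + 1 ≤ l).card = g ∨ l = m + 1) := by
  let P : ℕ → Prop := fun l => (q.filter fun x => (e.symm x : ℕ) + 1 ≤ l).card ≤ g
  have hPg : P g := card_filter_succ_le e q g
  have hP : P (Nat.findGreatest P (m + 1)) := Nat.findGreatest_spec (by omega) hPg
  have hle : Nat.findGreatest P (m + 1) ≤ m + 1 := Nat.findGreatest_le _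
  refine ⟨_, Nat.le_findGreatest (by omega) hPg, hle, hP, ?_⟩
  by_contra! hcon
  have hnot : ¬ P (Nat.findGreatest P (m + 1) + 1) :=
    Nat.findGreatest_is_greatest (Nat.lt_succ_self _) (by omega)
  generalize Nat.findGreatest P (m + 1) = l at hP hle hcon hnot
  obtain ⟨hne, hlm⟩ := hcon
  rcases Nat.lt_or_ge l m with h | h
  · have hstep := card_filter_succ_le_add_one e q h
    simp only [P] at hP hnot
    omega
  · obtain rfl : l = m := by omega
    refine hnot ((Finset.card_le_card fun x hx => ?_).trans hP)
    rw [Finset.mem_filter] at hx ⊢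
    exact ⟨hx.1, (e.symm x).isLt⟩

lemma dbarK_nonneg {E : Type*} [Fintype E] {k : ℕ} {δ : E → Fin k → ℝ} (hδ : ∀ x i, 0 ≤ δ x i)
    (e : Fin (Fintype.card E) ≃ E) (l : ℕ) (i : Fin k) : 0 ≤ dbarK δ e l i := by
  unfold dbarK
  split_ifs
  · exact hδ _ _
  · exact le_rfl

lemma dbarK_le_of_succ_le {E : Type*} [Fintype E] {k : ℕ} {δ : E → Fin k → ℝ}
    (hδ : ∀ x i, 0 ≤ δ x i) (e : Fin (Fintype.card E) ≃ E) {i : Fin k}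
    (hsort : Antitone fun a => δ (e a) i) {l : ℕ} {x : E} (hx : (e.symm x : ℕ) + 1 ≤ l) :
    dbarK δ e l i ≤ δ x i := by
  unfold dbarK
  split_ifs with h
  · have hle : e.symm x ≤ ⟨l - 1, h⟩ := Fin.le_def.mpr (by simp only; omega)
    simpa using hsort hle
  · exact hδ _ _

lemma le_dbarK_of_lt_succ {E : Type*} [Fintype E] {k : ℕ} {δ : E → Fin k → ℝ}
    (e : Fin (Fintype.card E) ≃ E) {i : Fin k}
    (hsort : Antitone fun a => δ (e a) i) {l : ℕ} {x : E} (hx : l < (e.symm x : ℕ) + 1) :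
    δ x i ≤ dbarK δ e l i := by
  have hlt := (e.symm x).isLt
  have h : l - 1 < Fintype.card E := by omega
  have hle : (⟨l - 1, h⟩ : Fin (Fintype.card E)) ≤ e.symm x :=
    Fin.le_def.mpr (by simp only; omega)
  rw [dbarK, dif_pos h]
  simpa using hsort hle

/-- Every `zBS^l` bounds the cost of `q` under any scenario in the uncertainty set. -/
lemma sum_le_zBSk {E : Type*} [Fintype E] [DecidableEq E] {k : ℕ} {n δ : E → Fin k → ℝ}
    (hδ : ∀ x i, 0 ≤ δ x i) {Γ : Fin k → ℕ} (e : Fin (Fintype.card E) ≃ E) {i : Fin k}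
    (hsort : Antitone fun a => δ (e a) i) (l : ℕ) (q : Finset E)
    {c : E → Fin k → ℝ} (hc : c ∈ Uk n δ Γ) :
    ∑ x ∈ q, c x i ≤ zBSk n δ Γ e l q i := by
  obtain ⟨hbound, hcard⟩ := hc
  set d := dbarK δ e l i with hd
  have hd0 : 0 ≤ d := dbarK_nonneg hδ e l i
  have hpoint : ∀ x ∈ q, c x i ≤ n x i + (if n x i < c x i then d else 0) +
      (if (e.symm x : ℕ) + 1 ≤ l then δ x i - d else 0) := by
    intro x _
    have hub := (hbound x i).2
    split_ifs with h1 h2 h2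
    · linarith
    · have := le_dbarK_of_lt_succ e hsort (not_le.mp h2)
      linarith
    · have := dbarK_le_of_succ_le hδ e hsort h2
      linarith
    · linarith
  have hcount : ∑ x ∈ q, (if n x i < c x i then d else 0) ≤ Γ i * d := by
    rw [← Finset.sum_filter, Finset.sum_const, nsmul_eq_mul]
    have hle : (q.filter fun x => n x i < c x i).card ≤ Γ i :=
      (Finset.card_le_card (Finset.filter_subset_filter _ (Finset.subset_univ q))).trans (hcard i)
    exact mul_le_mul_of_nonneg_right (by exact_mod_cast hle) hd0
  have hsum := Finset.sum_le_sum hpoint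
  rw [Finset.sum_add_distrib, Finset.sum_add_distrib] at hsum
  simp only [zBSk, ← hd, Finset.sum_filter]
  linarith

/-- The scenario raising exactly the elements of `T` to their upper bounds is admissible when
`T` has at most `Γ i` elements for every `i`. -/
lemma add_ite_mem_Uk {E : Type*} [Fintype E] [DecidableEq E] {k : ℕ} {n δ : E → Fin k → ℝ}
    (hδ : ∀ x i, 0 ≤ δ x i) {Γ : Fin k → ℕ} {T : Finset E} (hT : ∀ i, T.card ≤ Γ i) :
    (fun x i => n x i + if x ∈ T then δ x i else 0) ∈ Uk n δ Γ := by
  refine ⟨fun x i => ?_, fun i => (Finset.card_le_card fun x hx => ?_).trans (hT i)⟩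
  · have := hδ x i
    dsimp only
    split_ifs <;> constructor <;> linarith
  · by_contra hxT
    simp [hxT] at hx

/-- Under objective independent element order, for every `q ∈ Q` there is an index `l`
with `Γ_1 ≤ l ≤ m+1` such that `zBS^l_i(q) = zRC_i(q)` for all objectives `i`
simultaneously. -/
theorem stmt8 {E : Type*} [Fintype E] [DecidableEq E] [Nonempty E] {k : ℕ} (hk : 0 < k)
    (Q : Set (Finset E)) (hQ : Q.Nonempty)
    (n δ : E → Fin k → ℝ) (hδ : ∀ x i, 0 ≤ δ x i)
    (Γ : Fin k → ℕ) (hΓ1 : ∀ i, 1 ≤ Γ i) (hΓ2 : ∀ i, Γ i ≤ Fintype.card E)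
    (hΓeq : ∀ i j, Γ i = Γ j)
    (e : Fin (Fintype.card E) ≃ E)
    (hsort : ∀ i : Fin k, ∀ a b : Fin (Fintype.card E), a ≤ b → δ (e b) i ≤ δ (e a) i)
    (q : Finset E) (hq : q ∈ Q) :
    ∃ l : ℕ, Γ ⟨0, hk⟩ ≤ l ∧ l ≤ Fintype.card E + 1 ∧
      ∀ i, zBSk n δ Γ e l q i = zRCk n δ Γ q i := by
  have hΓ : ∀ i, Γ i = Γ ⟨0, hk⟩ := fun i => hΓeq i _
  obtain ⟨l, hgl, hlm, hcard, hcut⟩ := exists_cutoff e q (hΓ2 ⟨0, hk⟩)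
  refine ⟨l, hgl, hlm, fun i => ?_⟩
  have hmem := add_ite_mem_Uk (n := n) hδ (Γ := Γ) fun i => hcard.trans_eq (hΓ i).symm
  refine (IsGreatest.csSup_eq (s := {x : ℝ | ∃ c ∈ Uk n δ Γ, x = ∑ e ∈ q, c e i})
    ⟨⟨_, hmem, ?_⟩, ?_⟩).symm
  · have hmul : ((q.filter fun x => (e.symm x : ℕ) + 1 ≤ l).card : ℝ) * dbarK δ e l i =
        Γ i * dbarK δ e l i := by
      rcases hcut with h | h
      · rw [h, hΓ i]
      · simp [dbarK, h]
    rw [Finset.sum_add_distrib, ← Finset.sum_filter, Finset.filter_mem_eq_inter,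
      Finset.inter_eq_right.mpr (Finset.filter_subset _ _), zBSk, Finset.sum_sub_distrib,
      Finset.sum_const, nsmul_eq_mul, hmul]
    ring
  · rintro _ ⟨c, hc, rfl⟩
    exact sum_le_zBSk hδ e (fun a b hab => hsort i a b hab) l q hc
end

section
/- Assume objective independent element order. Let 1 ≤ l̃ ≤ l ≤ m+1 and let G ⊆ Q be a complete set of efficient solutions for the multi-objective problem min_{q∈Q} zBS^{l̃}(q). If no member of G contains any of the elements e_1, …, e_{l−1}, then G is a complete set of efficient solutions for min_{q∈Q} zBS^l(q). -/
open Finset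

/-- `y` dominates `y'` if `y_j ≤ y'_j` for all `j` and `y ≠ y'`. -/
def Dominates {ι : Type*} (y y' : ι → ℝ) : Prop := (∀ j, y j ≤ y' j) ∧ y ≠ y'

/-- `q` is an efficient solution of `min_{q ∈ Q} f(q)`:
`q ∈ Q` and no `q' ∈ Q` has `f q'` dominating `f q`. -/
def Efficient {E ι : Type*} (Q : Set (Finset E)) (f : Finset E → ι → ℝ)
    (q : Finset E) : Prop :=
  q ∈ Q ∧ ∀ q' ∈ Q, ¬ Dominates (f q') (f q)

/-- `G` is a complete set of efficient solutions for `f` on `Q`: `G ⊆ Q`, every member of `G`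
is efficient, and every `q ∈ Q` is dominated by, or has the same `f`-value as, a member of `G`. -/
def CompleteEff {E ι : Type*} (Q : Set (Finset E)) (f : Finset E → ι → ℝ)
    (G : Set (Finset E)) : Prop :=
  G ⊆ Q ∧ (∀ q ∈ G, Efficient Q f q) ∧
    ∀ q ∈ Q, ∃ q' ∈ G, Dominates (f q') (f q) ∨ f q' = f q

theorem completeEff_iff_weak {E ι : Type*} {Q : Set (Finset E)} {f : Finset E → ι → ℝ}
    {G : Set (Finset E)} :
    CompleteEff Q f G ↔ G ⊆ Q ∧ (∀ p ∈ G, ∀ q ∈ Q, f q ≤ f p → f q = f p) ∧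
      ∀ q ∈ Q, ∃ p ∈ G, f p ≤ f q := by
  have hdom (y y' : ι → ℝ) : Dominates y y' ∨ y = y' ↔ y ≤ y' := by
    constructor
    · rintro (h | rfl)
      exacts [h.1, le_rfl]
    · intro h
      by_cases heq : y = y'
      exacts [Or.inr heq, Or.inl ⟨h, heq⟩]
  simp only [CompleteEff, hdom]
  refine and_congr_right fun hGQ => and_congr_left fun _ => forall₂_congr fun p hp => ?_
  refine ⟨fun h q hq hle => ?_, fun h => ⟨hGQ hp, fun q hq hd => hd.2 (h q hq hd.1)⟩⟩
  by_contra hne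
  exact h.2 q hq ⟨hle, hne⟩

/-- A complete set of efficient solutions for `g` stays one for any `f` that lies above a translate
`g + c` on `Q` and agrees with it on the set. -/
theorem CompleteEff.of_add_le {E ι : Type*} {Q : Set (Finset E)} {f g : Finset E → ι → ℝ}
    {G : Set (Finset E)} (hG : CompleteEff Q g G) (c : ι → ℝ)
    (hle : ∀ q ∈ Q, g q + c ≤ f q) (heq : ∀ p ∈ G, f p = g p + c) :
    CompleteEff Q f G := by
  rw [completeEff_iff_weak] at hG ⊢
  obtain ⟨hGQ, heff, hcov⟩ := hG
  refine ⟨hGQ, fun p hp q hq h => le_antisymm h ?_, fun q hq => ?_⟩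
  · have hgle : g q ≤ g p := le_of_add_le_add_right ((hle q hq).trans (h.trans_eq (heq p hp)))
    rw [heq p hp, ← heff p hp q hq hgle]
    exact hle q hq
  · obtain ⟨p, hp, hpq⟩ := hcov q hq
    exact ⟨p, hp, (heq p hp).trans_le ((add_le_add_left hpq c).trans (hle q hq))⟩

theorem dbarK_le_of_index_le {E : Type*} [Fintype E] {k : ℕ} {δ : E → Fin k → ℝ}
    {e : Fin (Fintype.card E) ≃ E} {i : Fin k} (hδ : ∀ x, 0 ≤ δ x i)
    (hsort : ∀ a b : Fin (Fintype.card E), a ≤ b → δ (e b) i ≤ δ (e a) i)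
    {l : ℕ} {x : E} (hx : (e.symm x : ℕ) + 1 ≤ l) : dbarK δ e l i ≤ δ x i := by
  unfold dbarK
  split_ifs with h
  · have hidx : e.symm x ≤ ⟨l - 1, h⟩ := by
      rw [Fin.le_def]
      exact Nat.le_sub_one_of_lt hx
    simpa using hsort _ _ hidx
  · exact hδ x

theorem dbarK_antitone {E : Type*} [Fintype E] {k : ℕ} {δ : E → Fin k → ℝ}
    {e : Fin (Fintype.card E) ≃ E} {i : Fin k} (hδ : ∀ x, 0 ≤ δ x i)
    (hsort : ∀ a b : Fin (Fintype.card E), a ≤ b → δ (e b) i ≤ δ (e a) i) :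
    Antitone fun l => dbarK δ e l i := by
  intro l l' hl
  dsimp only [dbarK]
  split_ifs with h' h
  · exact hsort _ _ (Fin.le_def.2 (Nat.sub_le_sub_right hl 1))
  · omega
  · exact hδ _
  · exact le_rfl

theorem sum_filter_sub_dbarK_mono {E : Type*} [Fintype E] {k : ℕ} {δ : E → Fin k → ℝ}
    {e : Fin (Fintype.card E) ≃ E} {i : Fin k} (hδ : ∀ x, 0 ≤ δ x i)
    (hsort : ∀ a b : Fin (Fintype.card E), a ≤ b → δ (e b) i ≤ δ (e a) i) (q : Finset E) :
    Monotone fun l : ℕ =>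
      ∑ x ∈ q.filter (fun x => (e.symm x : ℕ) + 1 ≤ l), (δ x i - dbarK δ e l i) := by
  intro l l' hl
  refine (Finset.sum_le_sum fun x _ =>
    sub_le_sub_left (dbarK_antitone hδ hsort hl) (δ x i)).trans ?_
  refine Finset.sum_le_sum_of_subset_of_nonneg ?_ fun x hx _ => ?_
  · exact Finset.monotone_filter_right q fun x _ hx => hx.trans hl
  · exact sub_nonneg.2 (dbarK_le_of_index_le hδ hsort (Finset.mem_filter.1 hx).2)

theorem sum_filter_sub_dbarK_eq_zero {E : Type*} [Fintype E] {k : ℕ} {δ : E → Fin k → ℝ}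
    {e : Fin (Fintype.card E) ≃ E} {l : ℕ} {q : Finset E}
    (hq : ∀ j : Fin (Fintype.card E), (j : ℕ) + 1 ≤ l - 1 → e j ∉ q) (i : Fin k) :
    ∑ x ∈ q.filter (fun x => (e.symm x : ℕ) + 1 ≤ l), (δ x i - dbarK δ e l i) = 0 := by
  refine Finset.sum_eq_zero fun x hx => ?_
  obtain ⟨hxq, hxl⟩ := Finset.mem_filter.1 hx
  have hlow : ¬ (e.symm x : ℕ) + 1 ≤ l - 1 := fun h => hq _ h (by simpa using hxq)
  have hidx : l - 1 = (e.symm x : ℕ) := by omega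
  simp [dbarK, hidx]

/-- Under objective independent element order: if `1 ≤ l̃ ≤ l ≤ m+1` and `G` is a complete
set of efficient solutions for `min_{q∈Q} zBS^{l̃}(q)`, and no member of `G` contains any of
the elements `e_1, …, e_{l−1}` (1-based indices), then `G` is a complete set of efficient
solutions for `min_{q∈Q} zBS^l(q)`. -/
theorem stmt11 {E : Type*} [Fintype E] [DecidableEq E] [Nonempty E] {k : ℕ} (hk : 0 < k)
    (Q : Set (Finset E)) (hQ : Q.Nonempty)
    (n δ : E → Fin k → ℝ) (hδ : ∀ x i, 0 ≤ δ x i)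
    (Γ : Fin k → ℕ) (hΓ1 : ∀ i, 1 ≤ Γ i) (hΓ2 : ∀ i, Γ i ≤ Fintype.card E)
    (hΓeq : ∀ i j, Γ i = Γ j)
    (e : Fin (Fintype.card E) ≃ E)
    (hsort : ∀ i : Fin k, ∀ a b : Fin (Fintype.card E), a ≤ b → δ (e b) i ≤ δ (e a) i)
    (lt l : ℕ) (h1 : 1 ≤ lt) (h2 : lt ≤ l) (h3 : l ≤ Fintype.card E + 1)
    (G : Set (Finset E)) (hG : CompleteEff Q (zBSk n δ Γ e lt) G)
    (hnone : ∀ q ∈ G, ∀ j : Fin (Fintype.card E), (j : ℕ) + 1 ≤ l - 1 → e j ∉ q) :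
    CompleteEff Q (zBSk n δ Γ e l) G := by
  refine hG.of_add_le (fun i => Γ i * (dbarK δ e l i - dbarK δ e lt i))
    (fun q _ i => ?_) fun p hp => funext fun i => ?_
  · have hmono := sum_filter_sub_dbarK_mono (fun x => hδ x i) (hsort i) q h2
    simp only [Pi.add_apply, zBSk]
    linarith
  · have hnone_lt (j : Fin (Fintype.card E)) (hj : (j : ℕ) + 1 ≤ lt - 1) : e j ∉ p :=
      hnone p hp j (hj.trans (Nat.sub_le_sub_right h2 1))
    simp only [Pi.add_apply, zBSk, sum_filter_sub_dbarK_eq_zero (hnone p hp),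
      sum_filter_sub_dbarK_eq_zero hnone_lt]
    ring
end

section
/- Every efficient solution q of the multi-objective robust counterpart min_{q∈Q} zRC(q) (i.e., every q ∈ Q such that no q′ ∈ Q has zRC(q′) dominating zRC(q)) is an efficient solution of the deterministic multi-objective problem min_{q∈Q} zLA(q) with (Γ_1+1)+…+(Γ_k+1) objectives. -/
open Finset

/-- `kmax^i_j(q)`: the `j`-th largest value of the multiset `{δ_{e,i} : e ∈ q}`
(counted with multiplicity), and `0` if `|q| < j`. -/
noncomputable def kmaxK {E : Type*} {k : ℕ} (δ : E → Fin k → ℝ) (i : Fin k) (j : ℕ)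
    (q : Finset E) : ℝ :=
  ((q.val.map fun x => δ x i).sort (· ≥ ·)).getD (j - 1) 0

/-- The objective vector `zLA(q) ∈ ℝ^{(Γ_1+1)+…+(Γ_k+1)}`, the concatenation over
`i = 1,…,k` of the blocks `(∑_{e∈q} n_{e,i}, kmax^i_1(q), …, kmax^i_{Γ_i}(q))`,
indexed by the sigma type `(i : Fin k) × Fin (Γ i + 1)`. -/
noncomputable def zLA {E : Type*} {k : ℕ} (n δ : E → Fin k → ℝ) (Γ : Fin k → ℕ)
    (q : Finset E) : ((i : Fin k) × Fin (Γ i + 1)) → ℝ :=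
  fun p => if (p.2 : ℕ) = 0 then ∑ x ∈ q, n x p.1 else kmaxK δ p.1 (p.2 : ℕ) q

theorem sum_range_getD_eq_sum_take (L : List ℝ) (m : ℕ) :
    ∑ j ∈ Finset.range m, L.getD j 0 = (L.take m).sum := by
  induction m generalizing L with
  | zero => simp
  | succ m ih =>
    cases L with
    | nil => simp
    | cons a t =>
      rw [Finset.sum_range_succ', List.take_succ_cons, List.sum_cons, ← ih t, add_comm]
      simp

/-- In a nonnegative decreasing list, the first `m` entries have the largest sum
among all sublists of length at most `m`. -/
theorem List.Sublist.sum_le_sum_take {l L : List ℝ} (h : l.Sublist L)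
    (hs : L.Pairwise (· ≥ ·)) (h0 : ∀ x ∈ L, 0 ≤ x) {m : ℕ} (hm : l.length ≤ m) :
    l.sum ≤ (L.take m).sum := by
  induction L generalizing l m with
  | nil => simp [List.sublist_nil.mp h]
  | cons a t ih =>
    rw [List.pairwise_cons] at hs
    have ht0 : ∀ x ∈ t, 0 ≤ x := fun x hx => h0 x (List.mem_cons_of_mem _ hx)
    cases l with
    | nil =>
      exact List.sum_nonneg fun x hx => h0 x (List.mem_of_mem_take hx)
    | cons b l =>
      obtain ⟨m, rfl⟩ : ∃ m', m = m' + 1 := ⟨m - 1, by simp at hm; omega⟩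
      have hb : b ≤ a := by
        rcases List.mem_cons.mp (h.subset List.mem_cons_self) with rfl | hb
        · exact le_rfl
        · exact hs.1 b hb
      have hl : l.Sublist t := by simpa using h.tail
      have := ih hl hs.2 ht0 (m := m) (by simpa using hm)
      simp only [List.take_succ_cons, List.sum_cons]
      linarith

/-- The sum of the `m` largest values of a nonnegative function on a finset, as a maximum of sums
over subsets with at most `m` elements. -/
theorem isGreatest_sum_take_sort {E : Type*} [DecidableEq E] (f : E → ℝ) (hf : ∀ e, 0 ≤ f e)
    (q : Finset E) (m : ℕ) :
    IsGreatest {x | ∃ S ⊆ q, S.card ≤ m ∧ x = ∑ e ∈ S, f e}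
      (((q.val.map f).sort (· ≥ ·)).take m).sum := by
  constructor
  · let l := q.toList.insertionSort fun a b => f a ≥ f b
    have hperm : l.Perm q.toList := List.perm_insertionSort _ _
    have hsort : l.Pairwise fun a b => f a ≥ f b := by
      have : Std.Total fun a b => f a ≥ f b := ⟨fun a b => le_total _ _⟩
      have : IsTrans E fun a b => f a ≥ f b := ⟨fun a b c h h' => le_trans h' h⟩
      exact List.pairwise_insertionSort _ _
    have hnodup : l.Nodup := hperm.nodup_iff.mpr q.nodup_toList
    have hL : (q.val.map f).sort (· ≥ ·) = l.map f := by
      refine List.Perm.eq_of_pairwise' (r := (· ≥ ·)) (Multiset.pairwise_sort _ _)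
        (List.pairwise_map.mpr hsort) ?_
      rw [← Multiset.coe_eq_coe, Multiset.sort_eq, ← Multiset.map_coe,
        Multiset.coe_eq_coe.mpr hperm, Finset.coe_toList]
    have hnodup' : (l.take m).Nodup := hnodup.sublist (List.take_sublist _ _)
    refine ⟨(l.take m).toFinset, fun e he => ?_, ?_, ?_⟩
    · rw [List.mem_toFinset] at he
      exact Finset.mem_toList.mp (hperm.mem_iff.mp (List.mem_of_mem_take he))
    · exact (List.toFinset_card_le _).trans (List.length_take_le _ _)
    · rw [List.sum_toFinset f hnodup', hL, List.map_take]
  · rintro _ ⟨S, hS, hcard, rfl⟩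
    have hle : ((S.toList.map f : List ℝ) : Multiset ℝ) ≤
        (((q.val.map f).sort (· ≥ ·) : List ℝ) : Multiset ℝ) := by
      rw [Multiset.sort_eq, ← Multiset.map_coe, Finset.coe_toList]
      exact Multiset.map_le_map (Finset.val_le_iff.mpr hS)
    obtain ⟨l, hl, hsub⟩ := Multiset.coe_le.mp hle
    rw [← Finset.sum_map_toList, ← hl.sum_eq]
    refine hsub.sum_le_sum_take (Multiset.pairwise_sort _ _) (fun x hx => ?_) ?_
    · obtain ⟨e, -, rfl⟩ := Multiset.mem_map.mp ((Multiset.mem_sort (r := (· ≥ ·))).mp hx)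
      exact hf e
    · simpa [hl.length_eq] using hcard

theorem zRCk_eq {E : Type*} [Fintype E] [DecidableEq E] {k : ℕ} (n δ : E → Fin k → ℝ)
    (hδ : ∀ e i, 0 ≤ δ e i) (Γ : Fin k → ℕ) (q : Finset E) (i : Fin k) :
    zRCk n δ Γ q i =
      ∑ e ∈ q, n e i + ∑ j ∈ Finset.range (Γ i), kmaxK δ i (j + 1) q := by
  simp only [kmaxK, Nat.add_sub_cancel]
  rw [sum_range_getD_eq_sum_take]
  obtain ⟨⟨S, hS, hcard, hsum⟩, hub⟩ :=
    isGreatest_sum_take_sort (fun e => δ e i) (fun e => hδ e i) q (Γ i)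
  refine IsGreatest.csSup_eq ⟨?_, ?_⟩
  · refine ⟨fun e j => n e j + if j = i ∧ e ∈ S then δ e j else 0, ⟨fun e j => ?_, fun j => ?_⟩, ?_⟩
    · have := hδ e j
      dsimp only
      split_ifs <;> constructor <;> linarith
    · by_cases hj : j = i
      · subst hj
        refine (Finset.card_le_card fun e he => ?_).trans hcard
        by_contra heS
        simp [heS] at he
      · simp [hj]
    · rw [hsum, Finset.sum_add_distrib]
      simp [Finset.sum_ite_mem, Finset.inter_eq_right.mpr hS]
  · rintro _ ⟨c, ⟨hc, hcΓ⟩, rfl⟩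
    let T := q.filter fun e => n e i < c e i
    have hT : ∑ e ∈ T, δ e i ≤ _ :=
      hub ⟨T, Finset.filter_subset _ _,
        (Finset.card_le_card (Finset.filter_subset_filter _ (Finset.subset_univ q))).trans (hcΓ i),
        rfl⟩
    have hcT : ∑ e ∈ q, c e i ≤ ∑ e ∈ q, n e i + ∑ e ∈ T, δ e i := by
      rw [Finset.sum_filter, ← Finset.sum_add_distrib]
      refine Finset.sum_le_sum fun e _ => ?_
      have := hc e i
      split_ifs <;> linarith
    linarith

theorem zRCk_eq_sum_zLA {E : Type*} [Fintype E] [DecidableEq E] {k : ℕ} (n δ : E → Fin k → ℝ)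
    (hδ : ∀ e i, 0 ≤ δ e i) (Γ : Fin k → ℕ) (q : Finset E) (i : Fin k) :
    zRCk n δ Γ q i = ∑ j : Fin (Γ i + 1), zLA n δ Γ q ⟨i, j⟩ := by
  rw [zRCk_eq n δ hδ, Fin.sum_univ_succ, Finset.sum_range]
  simp [zLA]

/-- Every efficient solution of the multi-objective robust counterpart `min_{q∈Q} zRC(q)`
is an efficient solution of the deterministic multi-objective problem `min_{q∈Q} zLA(q)`
with `(Γ_1+1)+…+(Γ_k+1)` objectives. -/
theorem stmt17 {E : Type*} [Fintype E] [DecidableEq E] [Nonempty E] {k : ℕ} (hk : 0 < k)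
    (Q : Set (Finset E)) (hQ : Q.Nonempty)
    (n δ : E → Fin k → ℝ) (hδ : ∀ x i, 0 ≤ δ x i)
    (Γ : Fin k → ℕ) (hΓ1 : ∀ i, 1 ≤ Γ i) (hΓ2 : ∀ i, Γ i ≤ Fintype.card E)
    (q : Finset E) (hq : Efficient Q (zRCk n δ Γ) q) :
    Efficient Q (zLA n δ Γ) q := by
  refine ⟨hq.1, fun q' hq' ⟨hle, hne⟩ => hq.2 q' hq' ⟨fun i => ?_, fun heq => hne ?_⟩⟩
  · rw [zRCk_eq_sum_zLA n δ hδ, zRCk_eq_sum_zLA n δ hδ]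
    exact Finset.sum_le_sum fun j _ => hle ⟨i, j⟩
  · funext ⟨i, j⟩
    have hi := congrFun heq i
    rw [zRCk_eq_sum_zLA n δ hδ, zRCk_eq_sum_zLA n δ hδ] at hi
    exact (Finset.sum_eq_sum_iff_of_le fun j _ => hle ⟨i, j⟩).mp hi j (Finset.mem_univ j)
end
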